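/- arXiv:1606.05205 — 15 statements merged into one kernel-verified Lean document; each statement's English description precedes it below -/
import Mathlib

section
/- There exists a nonzero z ∈ Z with A^Z z + B (C z) = λ • j (i z) if and only if there exists a nonzero u ∈ U with C (Rλ (B u)) = u. (In other words, λ is an eigenvalue of the perturbed operator A_{BC} if and only if 1 is an eigenvalue of Δ_U(λ) = C ∘ Rλ ∘ B.) -/
/-- Theorem 2.3 (point spectrum): λ is an eigenvalue of A_{BC} iff 1 is an
eigenvalue of Δ_U(λ) = C ∘ R(λ,A^Z) ∘ B. -/
theorem eigenvalue_ABC_iff_eigenvalue_DeltaU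
    {U X Z Zm : Type*}
    [NormedAddCommGroup U] [NormedSpace ℂ U] [CompleteSpace U]
    [NormedAddCommGroup X] [NormedSpace ℂ X] [CompleteSpace X]
    [NormedAddCommGroup Z] [NormedSpace ℂ Z] [CompleteSpace Z]
    [NormedAddCommGroup Zm] [NormedSpace ℂ Zm] [CompleteSpace Zm]
    (i : Z →L[ℂ] X) (j : X →L[ℂ] Zm)
    (hi : Function.Injective i) (hj : Function.Injective j)
    (AZ : Z →L[ℂ] Zm) (B : U →L[ℂ] Zm) (C : Z →L[ℂ] U)
    (lam : ℂ) (Rlam : Zm →L[ℂ] Z)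
    (hR1 : ∀ z : Z, Rlam (lam • j (i z) - AZ z) = z)
    (hR2 : ∀ w : Zm, lam • j (i (Rlam w)) - AZ (Rlam w) = w) :
    (∃ z : Z, z ≠ 0 ∧ AZ z + B (C z) = lam • j (i z)) ↔
      (∃ u : U, u ≠ 0 ∧ C (Rlam (B u)) = u) := by
  constructor
  · rintro ⟨z, hz, h⟩
    have hz' : Rlam (B (C z)) = z := by
      rw [eq_sub_of_add_eq' h, hR1]
    refine ⟨C z, fun h0 => hz ?_, by rw [hz']⟩
    rw [← hz', h0, map_zero, map_zero]
  · rintro ⟨u, hu, h⟩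
    refine ⟨Rlam (B u), fun h0 => hu ?_, ?_⟩
    · rw [← h, h0, map_zero]
    · rw [h]
      exact (sub_eq_iff_eq_add'.mp (hR2 (B u))).symm
end

section
/- Let K := {z ∈ Z : A^Z z + B (C z) = λ • j (i z)} (the kernel of λ - A_{BC}). Then: (a) K equals the kernel of Id_Z - Rλ ∘ B ∘ C; (b) K equals the image under Rλ ∘ B of the kernel of Id_U - C ∘ Rλ ∘ B; and (c) the image of K under C equals the kernel of Id_U - C ∘ Rλ ∘ B. -/
/-- Corollary 2.6: for λ ∈ ρ(A), with K = ker(λ - A_{BC}),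
(a) K = ker(Id_Z - Δ_Z(λ)),
(b) K = R(λ,A^Z)B (ker(Id_U - Δ_U(λ))),
(c) C K = ker(Id_U - Δ_U(λ)). -/
theorem kernel_ABC_eq
    {U X Z Zm : Type*}
    [NormedAddCommGroup U] [NormedSpace ℂ U] [CompleteSpace U]
    [NormedAddCommGroup X] [NormedSpace ℂ X] [CompleteSpace X]
    [NormedAddCommGroup Z] [NormedSpace ℂ Z] [CompleteSpace Z]
    [NormedAddCommGroup Zm] [NormedSpace ℂ Zm] [CompleteSpace Zm]
    (i : Z →L[ℂ] X) (j : X →L[ℂ] Zm)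
    (hi : Function.Injective i) (hj : Function.Injective j)
    (AZ : Z →L[ℂ] Zm) (B : U →L[ℂ] Zm) (C : Z →L[ℂ] U)
    (lam : ℂ) (Rlam : Zm →L[ℂ] Z)
    (hR1 : ∀ z : Z, Rlam (lam • j (i z) - AZ z) = z)
    (hR2 : ∀ w : Zm, lam • j (i (Rlam w)) - AZ (Rlam w) = w) :
    {z : Z | AZ z + B (C z) = lam • j (i z)} = {z : Z | z - Rlam (B (C z)) = 0} ∧
    {z : Z | AZ z + B (C z) = lam • j (i z)} =
      (fun u : U => Rlam (B u)) '' {u : U | u - C (Rlam (B u)) = 0} ∧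
    C '' {z : Z | AZ z + B (C z) = lam • j (i z)} = {u : U | u - C (Rlam (B u)) = 0} := by
  have hK : ∀ z : Z, AZ z + B (C z) = lam • j (i z) ↔ Rlam (B (C z)) = z := by
    intro z
    constructor
    · intro h
      rw [eq_sub_of_add_eq' h, hR1]
    · intro h
      have h' := hR2 (B (C z))
      rw [h] at h'
      rw [← h', add_sub_cancel]
  simp only [hK, sub_eq_zero]
  refine ⟨Set.ext fun z => eq_comm, Set.ext fun z => ⟨fun h => ?_, ?_⟩,
    Set.ext fun u => ⟨?_, fun h => ?_⟩⟩
  · exact ⟨C z, (congrArg C h).symm, h⟩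
  · rintro ⟨u, hu, rfl⟩
    exact congrArg (fun v => Rlam (B v)) hu.symm
  · rintro ⟨z, hz, rfl⟩
    exact (congrArg C hz).symm
  · exact ⟨Rlam (B u), congrArg (fun v => Rlam (B v)) h.symm, h.symm⟩
end

section
/- Suppose M : U → U is a continuous linear map with (Id_U - C∘Rλ∘B) ∘ M = Id_U and M ∘ (Id_U - C∘Rλ∘B) = Id_U. Then: (a) Id_Z - Rλ∘B∘C : Z → Z is invertible with two-sided inverse Id_Z + Rλ∘B∘M∘C; (b) the linear map Ψ : Z → Z₋₁ defined by Ψ z := λ • j (i z) - A^Z z - B (C z) is injective; and (c) for every x ∈ X, the element z_x := Rλ (j x) + Rλ (B (M (C (Rλ (j x))))) of Z satisfies Ψ z_x = j x. (In particular λ ∈ ρ(A_{BC}) and the resolvent is given by formulas (2.6)–(2.7): R(λ, A_{BC}) x = i z_x.) -/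
/-- Theorem 2.3.(e): if Id_U - Δ_U(λ) is invertible with inverse M, then
(a) Id_Z - Δ_Z(λ) is invertible with inverse Id_Z + R(λ,A^Z)∘B∘M∘C,
(b) λ - A^Z_{BC} is injective, and
(c) the resolvent formulas (2.6)-(2.7) hold: for every x ∈ X the element
z_x = R(λ,A^Z)(j x) + R(λ,A^Z)(B (M (C (R(λ,A^Z)(j x))))) satisfies
(λ - A^Z - BC) z_x = j x. -/
theorem resolvent_ABC_formula
    {U X Z Zm : Type*}
    [NormedAddCommGroup U] [NormedSpace ℂ U] [CompleteSpace U]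
    [NormedAddCommGroup X] [NormedSpace ℂ X] [CompleteSpace X]
    [NormedAddCommGroup Z] [NormedSpace ℂ Z] [CompleteSpace Z]
    [NormedAddCommGroup Zm] [NormedSpace ℂ Zm] [CompleteSpace Zm]
    (i : Z →L[ℂ] X) (j : X →L[ℂ] Zm)
    (hi : Function.Injective i) (hj : Function.Injective j)
    (AZ : Z →L[ℂ] Zm) (B : U →L[ℂ] Zm) (C : Z →L[ℂ] U)
    (lam : ℂ) (Rlam : Zm →L[ℂ] Z)
    (hR1 : ∀ z : Z, Rlam (lam • j (i z) - AZ z) = z)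
    (hR2 : ∀ w : Zm, lam • j (i (Rlam w)) - AZ (Rlam w) = w)
    (M : U →L[ℂ] U)
    (hM1 : ∀ u : U, M u - C (Rlam (B (M u))) = u)
    (hM2 : ∀ u : U, M (u - C (Rlam (B u))) = u) :
    (∀ z : Z,
        (z + Rlam (B (M (C z)))) - Rlam (B (C (z + Rlam (B (M (C z)))))) = z ∧
        (z - Rlam (B (C z))) + Rlam (B (M (C (z - Rlam (B (C z)))))) = z) ∧
    Function.Injective (fun z : Z => lam • j (i z) - AZ z - B (C z)) ∧
    (∀ x : X,
        lam • j (i (Rlam (j x) + Rlam (B (M (C (Rlam (j x)))))))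
          - AZ (Rlam (j x) + Rlam (B (M (C (Rlam (j x))))))
          - B (C (Rlam (j x) + Rlam (B (M (C (Rlam (j x))))))) = j x) := by
  have hM1' (u : U) : C (Rlam (B (M u))) = M u - u := by
    rw [eq_sub_iff_add_eq', ← eq_sub_iff_add_eq]
    exact (hM1 u).symm
  have hleft (z : Z) :
      (z - Rlam (B (C z))) + Rlam (B (M (C (z - Rlam (B (C z)))))) = z := by
    rw [map_sub C, hM2]
    abel
  refine ⟨fun z => ⟨?_, hleft z⟩, fun z w h => ?_, fun x => ?_⟩
  · simp only [map_add, map_sub, hM1']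
    abel
  · have h' : z - Rlam (B (C z)) = w - Rlam (B (C w)) := by
      simpa only [map_sub Rlam _ (B _), hR1] using congrArg Rlam h
    rw [← hleft z, ← hleft w, h']
  · have hBC : B (C (Rlam (j x) + Rlam (B (M (C (Rlam (j x))))))) =
        B (M (C (Rlam (j x)))) := by
      rw [map_add C, hM1', add_sub_cancel]
    rw [hBC, ← map_add Rlam, hR2, add_sub_cancel_right]
end

section
/- The linear map Ψ : Z → Z₋₁ defined by Ψ z := λ • j (i z) - A^Z z - B (C z) (i.e. λ - A^Z_{BC}) is surjective if and only if Id_U - C∘Rλ∘B : U → U is surjective; moreover, if Id_U - C∘Rλ∘B is surjective, then for every x ∈ X there exists z ∈ Z with Ψ z = j x (i.e. λ - A_{BC} is surjective). -/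
/-- Remark 2.4.(iv): λ - A^Z_{BC} is surjective iff Id_U - Δ_U(λ) is surjective;
moreover surjectivity of Id_U - Δ_U(λ) implies surjectivity of λ - A_{BC}. -/
theorem surjective_ABC_iff
    {U X Z Zm : Type*}
    [NormedAddCommGroup U] [NormedSpace ℂ U] [CompleteSpace U]
    [NormedAddCommGroup X] [NormedSpace ℂ X] [CompleteSpace X]
    [NormedAddCommGroup Z] [NormedSpace ℂ Z] [CompleteSpace Z]
    [NormedAddCommGroup Zm] [NormedSpace ℂ Zm] [CompleteSpace Zm]
    (i : Z →L[ℂ] X) (j : X →L[ℂ] Zm)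
    (hi : Function.Injective i) (hj : Function.Injective j)
    (AZ : Z →L[ℂ] Zm) (B : U →L[ℂ] Zm) (C : Z →L[ℂ] U)
    (lam : ℂ) (Rlam : Zm →L[ℂ] Z)
    (hR1 : ∀ z : Z, Rlam (lam • j (i z) - AZ z) = z)
    (hR2 : ∀ w : Zm, lam • j (i (Rlam w)) - AZ (Rlam w) = w) :
    (Function.Surjective (fun z : Z => lam • j (i z) - AZ z - B (C z)) ↔
      Function.Surjective (fun u : U => u - C (Rlam (B u)))) ∧
    (Function.Surjective (fun u : U => u - C (Rlam (B u))) →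
      ∀ x : X, ∃ z : Z, lam • j (i z) - AZ z - B (C z) = j x) := by
  have surj_of_surj (h : Function.Surjective (fun u : U => u - C (Rlam (B u)))) :
      Function.Surjective (fun z : Z => lam • j (i z) - AZ z - B (C z)) := by
    intro w
    obtain ⟨u, hu⟩ := h (C (Rlam w))
    have hC : C (Rlam (w + B u)) = u := by
      rw [map_add, map_add]
      exact (sub_eq_iff_eq_add.mp hu).symm
    refine ⟨Rlam (w + B u), ?_⟩
    simp only [hR2, hC, add_sub_cancel_right]
  refine ⟨⟨fun h u => ?_, surj_of_surj⟩, fun h x => surj_of_surj h (j x)⟩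
  obtain ⟨z, hz⟩ := h (B u)
  have hRz : Rlam (B (u + C z)) = z := by
    rw [map_add, ← sub_eq_iff_eq_add.mp hz, hR1]
  refine ⟨u + C z, ?_⟩
  simp only [hRz, add_sub_cancel_right]
end

section
/- Assume Δ_U(λ) = C∘Rλ∘B : U → U is a compact operator. Then there exists a nonzero z ∈ Z with A^Z z + B (C z) = λ • j (i z) if and only if it is NOT the case that for every x ∈ X there exists a unique z ∈ Z with λ • j (i z) - A^Z z - B (C z) = j x. (That is, for compact Δ_U(λ), λ ∈ σ(A_{BC}) if and only if λ ∈ σ_p(A_{BC}).) -/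
/-- Theorem 2.3.(c): if Δ_U(λ) is compact then λ ∈ σ(A_{BC}) iff λ ∈ σ_p(A_{BC}):
there exists a nonzero eigenvector iff λ - A_{BC} is not bijective from D(A_{BC}) onto X. -/
theorem compact_DeltaU_spectrum_eq_point_spectrum
    {U X Z Zm : Type*}
    [NormedAddCommGroup U] [NormedSpace ℂ U] [CompleteSpace U]
    [NormedAddCommGroup X] [NormedSpace ℂ X] [CompleteSpace X]
    [NormedAddCommGroup Z] [NormedSpace ℂ Z] [CompleteSpace Z]
    [NormedAddCommGroup Zm] [NormedSpace ℂ Zm] [CompleteSpace Zm]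
    (i : Z →L[ℂ] X) (j : X →L[ℂ] Zm)
    (hi : Function.Injective i) (hj : Function.Injective j)
    (AZ : Z →L[ℂ] Zm) (B : U →L[ℂ] Zm) (C : Z →L[ℂ] U)
    (lam : ℂ) (Rlam : Zm →L[ℂ] Z)
    (hR1 : ∀ z : Z, Rlam (lam • j (i z) - AZ z) = z)
    (hR2 : ∀ w : Zm, lam • j (i (Rlam w)) - AZ (Rlam w) = w)
    (hcomp : IsCompactOperator (fun u : U => C (Rlam (B u)))) :
    (∃ z : Z, z ≠ 0 ∧ AZ z + B (C z) = lam • j (i z)) ↔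
      ¬ (∀ x : X, ∃! z : Z, lam • j (i z) - AZ z - B (C z) = j x) := by
  constructor
  · rintro ⟨z, hz, hev⟩ h
    obtain ⟨y, -, hy⟩ := h 0
    have hzy : z = y := hy z (by simp [← hev])
    have h0y : 0 = y := hy 0 (by simp)
    exact hz (hzy.trans h0y.symm)
  · contrapose!
    intro hne x
    have hT : IsCompactOperator (C ∘L Rlam ∘L B) := hcomp
    have hbij : Function.Bijective (1 - C ∘L Rlam ∘L B : U →L[ℂ] U) := by
      have hres : (1 : ℂ) ∈ resolventSet ℂ (C ∘L Rlam ∘L B) := by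
        refine (hT.hasEigenvalue_or_mem_resolventSet one_ne_zero).resolve_left fun hev => ?_
        obtain ⟨u, hu⟩ := hev.exists_hasEigenvector
        have hfix : C (Rlam (B u)) = u := by simpa using hu.apply_eq_smul
        refine hne (Rlam (B u)) (fun hz => hu.2 (by rw [← hfix, hz, map_zero])) ?_
        rw [hfix, add_comm, ← eq_sub_iff_add_eq, hR2]
      rwa [spectrum.mem_resolventSet_iff, map_one,
        ContinuousLinearMap.isUnit_iff_bijective] at hres
    obtain ⟨u, hu⟩ := hbij.surjective (C (Rlam (j x)))
    have hu : u - C (Rlam (B u)) = C (Rlam (j x)) := by simpa using hu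
    have hCz : C (Rlam (j x + B u)) = u := by
      rw [map_add, map_add, ← hu, sub_add_cancel]
    have hsol : lam • j (i (Rlam (j x + B u))) - AZ (Rlam (j x + B u)) -
        B (C (Rlam (j x + B u))) = j x := by
      rw [hR2, hCz, add_sub_cancel_right]
    refine ⟨_, hsol, fun y hy => ?_⟩
    by_contra hyz
    refine hne _ (sub_ne_zero.mpr hyz) ?_
    have heq := hy.trans hsol.symm
    simp only [map_sub, smul_sub]
    linear_combination (norm := module) -heq
end

section
/- Assume S : F → H is bijective with continuous inverse S⁻¹ : H → F, and set Δ₁ := P - Q∘S⁻¹∘R : E → G (the first Schur complement of 𝒯). Then: 𝒯 is injective if and only if Δ₁ is injective; 𝒯 is surjective if and only if Δ₁ is surjective; the range of 𝒯 is closed in G × H if and only if the range of Δ₁ is closed in G; and 𝒯 has dense range if and only if Δ₁ has dense range. -/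
/-- Lemma A.10.(i): if S is invertible then the operator matrix
𝒯(x,y) = (Px + Qy, Rx + Sy) is injective / surjective / has closed range /
has dense range iff the Schur complement Δ₁ = P - Q S⁻¹ R has the same property. -/
theorem schur_complement_one
    {E F G H : Type*}
    [NormedAddCommGroup E] [NormedSpace ℂ E] [CompleteSpace E]
    [NormedAddCommGroup F] [NormedSpace ℂ F] [CompleteSpace F]
    [NormedAddCommGroup G] [NormedSpace ℂ G] [CompleteSpace G]
    [NormedAddCommGroup H] [NormedSpace ℂ H] [CompleteSpace H]
    (P : E →L[ℂ] G) (Q : F →L[ℂ] G) (R : E →L[ℂ] H) (S : F →L[ℂ] H)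
    (Sinv : H →L[ℂ] F)
    (hS1 : ∀ h : H, S (Sinv h) = h) (hS2 : ∀ f : F, Sinv (S f) = f) :
    (Function.Injective (fun q : E × F => (P q.1 + Q q.2, R q.1 + S q.2)) ↔
      Function.Injective (fun x : E => P x - Q (Sinv (R x)))) ∧
    (Function.Surjective (fun q : E × F => (P q.1 + Q q.2, R q.1 + S q.2)) ↔
      Function.Surjective (fun x : E => P x - Q (Sinv (R x)))) ∧
    (IsClosed (Set.range (fun q : E × F => (P q.1 + Q q.2, R q.1 + S q.2))) ↔
      IsClosed (Set.range (fun x : E => P x - Q (Sinv (R x))))) ∧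
    (Dense (Set.range (fun q : E × F => (P q.1 + Q q.2, R q.1 + S q.2))) ↔
      Dense (Set.range (fun x : E => P x - Q (Sinv (R x))))) := by
  let φ : G × H →L[ℂ] G :=
    ContinuousLinearMap.fst ℂ G H - (Q.comp Sinv).comp (ContinuousLinearMap.snd ℂ G H)
  have hφ (p : G × H) : φ p = p.1 - Q (Sinv p.2) := rfl
  have hsurj : Function.Surjective φ := fun g => ⟨(g, 0), by simp [hφ]⟩
  have hquot : IsOpenQuotientMap φ := ⟨hsurj, φ.continuous, φ.isOpenMap hsurj⟩
  have hrange : Set.range (fun q : E × F => (P q.1 + Q q.2, R q.1 + S q.2)) =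
      φ ⁻¹' Set.range (fun x : E => P x - Q (Sinv (R x))) := by
    ext ⟨g, h⟩
    simp only [Set.mem_range, Set.mem_preimage, hφ, Prod.exists, Prod.mk.injEq]
    constructor
    · rintro ⟨x, y, rfl, rfl⟩
      refine ⟨x, ?_⟩
      rw [map_add, hS2, map_add]
      abel
    · rintro ⟨x, hx⟩
      refine ⟨x, Sinv (h - R x), ?_, ?_⟩
      · rw [map_sub, map_sub, add_sub_left_comm, hx]
        abel
      · rw [hS1]
        abel
  refine ⟨⟨fun hT x x' hx => ?_, ?_⟩, ?_, ?_, ?_⟩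
  · have key := @hT (x, -Sinv (R x)) (x', -Sinv (R x'))
      (by simpa [hS1, sub_eq_add_neg] using hx)
    exact congrArg Prod.fst key
  · rintro hΔ ⟨x, y⟩ ⟨x', y'⟩ hq
    have hx : x = x' := hΔ (by simpa [hφ, hS2] using congrArg φ hq)
    subst hx
    have hy : S y = S y' := by simpa using congrArg Prod.snd hq
    rw [← hS2 y, hy, hS2]
  · rw [← Set.range_eq_univ, ← Set.range_eq_univ, hrange, ← Set.preimage_univ (f := φ)]
    exact hsurj.preimage_injective.eq_iff
  · rw [hrange]
    exact hquot.isQuotientMap.isClosed_preimage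
  · rw [hrange]
    exact hquot.dense_preimage_iff
end

section
/- Assume P : E → G and S : F → H are both bijective with continuous inverses P⁻¹ and S⁻¹, and set Δ₁ := P - Q∘S⁻¹∘R : E → G and Δ₂ := S - R∘P⁻¹∘Q : F → H (the two Schur complements of 𝒯). Then ker Δ₁ = (P⁻¹∘Q) '' (ker Δ₂) and ker Δ₂ = (S⁻¹∘R) '' (ker Δ₁), i.e. the kernel of Δ₁ is the image of the kernel of Δ₂ under P⁻¹∘Q, and the kernel of Δ₂ is the image of the kernel of Δ₁ under S⁻¹∘R. -/
/-- If `Pinv` and `Sinv` are two-sided inverses of `P` and `S`, then `Pinv ∘ Q` maps the solutions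
of `S y = R (Pinv (Q y))` onto the solutions of `P x = Q (Sinv (R x))`. -/
theorem setOf_schur_eq_image {E F G H : Type*} {P : E → G} {Q : F → G} {R : E → H} {S : F → H}
    {Pinv : G → E} {Sinv : H → F}
    (hP : Function.RightInverse Pinv P) (hP' : Function.LeftInverse Pinv P)
    (hS : Function.RightInverse Sinv S) (hS' : Function.LeftInverse Sinv S) :
    {x | P x = Q (Sinv (R x))} = (fun y => Pinv (Q y)) '' {y | S y = R (Pinv (Q y))} := by
  ext x
  simp only [Set.mem_ofPred_eq, Set.mem_image]
  constructor
  · intro hx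
    have hx' : Pinv (Q (Sinv (R x))) = x := by rw [← hx, hP']
    exact ⟨Sinv (R x), by rw [hx', hS], hx'⟩
  · rintro ⟨y, hy, rfl⟩
    rw [← hy, hS', hP]

/-- Lemma A.10.(iii): if P and S are invertible, then for the Schur complements
Δ₁ = P - Q S⁻¹ R and Δ₂ = S - R P⁻¹ Q one has
ker Δ₁ = P⁻¹ Q (ker Δ₂) and ker Δ₂ = S⁻¹ R (ker Δ₁). -/
theorem schur_complement_kernels
    {E F G H : Type*}
    [NormedAddCommGroup E] [NormedSpace ℂ E] [CompleteSpace E]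
    [NormedAddCommGroup F] [NormedSpace ℂ F] [CompleteSpace F]
    [NormedAddCommGroup G] [NormedSpace ℂ G] [CompleteSpace G]
    [NormedAddCommGroup H] [NormedSpace ℂ H] [CompleteSpace H]
    (P : E →L[ℂ] G) (Q : F →L[ℂ] G) (R : E →L[ℂ] H) (S : F →L[ℂ] H)
    (Pinv : G →L[ℂ] E)
    (hP1 : ∀ g : G, P (Pinv g) = g) (hP2 : ∀ e : E, Pinv (P e) = e)
    (Sinv : H →L[ℂ] F)
    (hS1 : ∀ h : H, S (Sinv h) = h) (hS2 : ∀ f : F, Sinv (S f) = f) :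
    {x : E | P x - Q (Sinv (R x)) = 0} =
        (fun y : F => Pinv (Q y)) '' {y : F | S y - R (Pinv (Q y)) = 0} ∧
    {y : F | S y - R (Pinv (Q y)) = 0} =
        (fun x : E => Sinv (R x)) '' {x : E | P x - Q (Sinv (R x)) = 0} := by
  simp only [sub_eq_zero]
  exact ⟨setOf_schur_eq_image hP1 hP2 hS1 hS2, setOf_schur_eq_image hS1 hS2 hP1 hP2⟩
end

section
/- Assume P : E → G and S : F → H are both bijective with continuous inverses P⁻¹ and S⁻¹, and set Δ₁ := P - Q∘S⁻¹∘R : E → G and Δ₂ := S - R∘P⁻¹∘Q : F → H. Then Δ₁ is bijective if and only if Δ₂ is bijective, and in that case the (continuous) inverses satisfy Δ₁⁻¹ = P⁻¹ + P⁻¹∘Q∘Δ₂⁻¹∘R∘P⁻¹ and Δ₂⁻¹ = S⁻¹ + S⁻¹∘R∘Δ₁⁻¹∘Q∘S⁻¹. -/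
section SchurComplement

variable {𝕜 E F G H : Type*} [Ring 𝕜]
  [AddCommGroup E] [Module 𝕜 E] [AddCommGroup F] [Module 𝕜 F]
  [AddCommGroup G] [Module 𝕜 G] [AddCommGroup H] [Module 𝕜 H]
  {P : E →ₗ[𝕜] G} {Q : F →ₗ[𝕜] G} {R : E →ₗ[𝕜] H} {S : F →ₗ[𝕜] H}
  {Pinv : G →ₗ[𝕜] E} {Sinv : H →ₗ[𝕜] F}

/-- A solution of the equation for the complement of `P` yields one for the complement of `S`. -/
theorem schur_complement_apply_of_apply_eq
    (hP : Function.RightInverse Pinv P) (hS : Function.LeftInverse Sinv S)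
    {g : G} {y : F} (hy : S y - R (Pinv (Q y)) = R (Pinv g)) :
    P (Pinv g + Pinv (Q y)) - Q (Sinv (R (Pinv g + Pinv (Q y)))) = g := by
  have h : R (Pinv g + Pinv (Q y)) = S y := by
    rw [map_add, ← hy, sub_add_cancel]
  rw [h, hS y, map_add, hP g, hP (Q y), add_sub_cancel_right]

theorem schur_complement_bijective_of_bijective
    (hP₁ : Function.RightInverse Pinv P) (hP₂ : Function.LeftInverse Pinv P)
    (hS₁ : Function.RightInverse Sinv S) (hS₂ : Function.LeftInverse Sinv S)
    (h : Function.Bijective fun y : F => S y - R (Pinv (Q y))) :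
    Function.Bijective fun x : E => P x - Q (Sinv (R x)) := by
  refine ⟨?_, fun g => ?_⟩
  · change Function.Injective (P - Q ∘ₗ Sinv ∘ₗ R)
    refine (injective_iff_map_eq_zero _).2 fun x hx => ?_
    have hx' : P x = Q (Sinv (R x)) := sub_eq_zero.1 hx
    have hy : Sinv (R x) = 0 := h.1 (by
      simp only [map_zero, sub_zero]
      rw [hS₁ (R x), ← hx', hP₂ x, sub_self])
    rw [← hP₂ x, hx', hy, map_zero, map_zero]
  · obtain ⟨y, hy⟩ := h.2 (R (Pinv g))
    exact ⟨_, schur_complement_apply_of_apply_eq hP₁ hS₂ hy⟩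

end SchurComplement


/-- Lemma A.10.(vi): if P and S are invertible then the Schur complement
Δ₁ = P - Q S⁻¹ R is bijective iff Δ₂ = S - R P⁻¹ Q is bijective, and in that case
Δ₁⁻¹ = P⁻¹ + P⁻¹ Q Δ₂⁻¹ R P⁻¹ and Δ₂⁻¹ = S⁻¹ + S⁻¹ R Δ₁⁻¹ Q S⁻¹. -/
theorem schur_complement_bijective_iff
    {E F G H : Type*}
    [NormedAddCommGroup E] [NormedSpace ℂ E] [CompleteSpace E]
    [NormedAddCommGroup F] [NormedSpace ℂ F] [CompleteSpace F]
    [NormedAddCommGroup G] [NormedSpace ℂ G] [CompleteSpace G]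
    [NormedAddCommGroup H] [NormedSpace ℂ H] [CompleteSpace H]
    (P : E →L[ℂ] G) (Q : F →L[ℂ] G) (R : E →L[ℂ] H) (S : F →L[ℂ] H)
    (Pinv : G →L[ℂ] E)
    (hP1 : ∀ g : G, P (Pinv g) = g) (hP2 : ∀ e : E, Pinv (P e) = e)
    (Sinv : H →L[ℂ] F)
    (hS1 : ∀ h : H, S (Sinv h) = h) (hS2 : ∀ f : F, Sinv (S f) = f) :
    (Function.Bijective (fun x : E => P x - Q (Sinv (R x))) ↔
        Function.Bijective (fun y : F => S y - R (Pinv (Q y)))) ∧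
    (∀ (D₁ : G → E) (D₂ : H → F),
      (∀ g : G, P (D₁ g) - Q (Sinv (R (D₁ g))) = g) →
      (∀ x : E, D₁ (P x - Q (Sinv (R x))) = x) →
      (∀ h : H, S (D₂ h) - R (Pinv (Q (D₂ h))) = h) →
      (∀ y : F, D₂ (S y - R (Pinv (Q y))) = y) →
      (∀ g : G, D₁ g = Pinv g + Pinv (Q (D₂ (R (Pinv g))))) ∧
      (∀ h : H, D₂ h = Sinv h + Sinv (R (D₁ (Q (Sinv h)))))) := by
  refine ⟨⟨fun h => ?_, fun h => ?_⟩, fun D₁ D₂ h₁ h₁' h₂ h₂' => ⟨fun g => ?_, fun h => ?_⟩⟩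
  · exact schur_complement_bijective_of_bijective (P := S.toLinearMap) (Q := R.toLinearMap)
      (R := Q.toLinearMap) (S := P.toLinearMap) (Pinv := Sinv.toLinearMap)
      (Sinv := Pinv.toLinearMap) hS1 hS2 hP1 hP2 h
  · exact schur_complement_bijective_of_bijective (P := P.toLinearMap) (Q := Q.toLinearMap)
      (R := R.toLinearMap) (S := S.toLinearMap) (Pinv := Pinv.toLinearMap)
      (Sinv := Sinv.toLinearMap) hP1 hP2 hS1 hS2 h
  · have key := schur_complement_apply_of_apply_eq (P := P.toLinearMap) (Q := Q.toLinearMap)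
      (R := R.toLinearMap) (S := S.toLinearMap) (Pinv := Pinv.toLinearMap)
      (Sinv := Sinv.toLinearMap) hP1 hS2 (h₂ (R (Pinv g)))
    exact (congrArg D₁ key).symm.trans (h₁' _)
  · have key := schur_complement_apply_of_apply_eq (P := S.toLinearMap) (Q := R.toLinearMap)
      (R := Q.toLinearMap) (S := P.toLinearMap) (Pinv := Sinv.toLinearMap)
      (Sinv := Pinv.toLinearMap) hS1 hP2 (h₁ (Q (Sinv h)))
    exact (congrArg D₂ key).symm.trans (h₂' _)
end

section
/- The operator Id_E - Q∘R : E → E is injective if and only if Id_F - R∘Q : F → F is injective; Id_E - Q∘R is surjective if and only if Id_F - R∘Q is surjective; Id_E - Q∘R has dense range if and only if Id_F - R∘Q has dense range; and the range of Id_E - Q∘R is closed in E if and only if the range of Id_F - R∘Q is closed in F. (Hence 1 ∈ σ_*(QR) ⟺ 1 ∈ σ_*(RQ) for * ∈ {p, a, r, c} and 1 ∈ σ(QR) ⟺ 1 ∈ σ(RQ).) -/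
section OneSubComp

variable {𝕜 E F : Type*} [Semiring 𝕜]
  [AddCommGroup E] [Module 𝕜 E] [TopologicalSpace E]
  [AddCommGroup F] [Module 𝕜 F] [TopologicalSpace F]

theorem injective_one_sub_comp_swap (Q : F →L[𝕜] E) (R : E →L[𝕜] F)
    (h : Function.Injective (fun x : E => x - Q (R x))) :
    Function.Injective (fun y : F => y - R (Q y)) := by
  intro y z hyz
  have hyz' : y - R (Q y) = z - R (Q z) := hyz
  have hQ : Q y = Q z := h (by simpa only [map_sub] using congrArg Q hyz')
  rwa [hQ, sub_left_inj] at hyz'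

theorem range_one_sub_comp_swap (Q : F →L[𝕜] E) (R : E →L[𝕜] F) :
    Set.range (fun y : F => y - R (Q y)) = Q ⁻¹' Set.range (fun x : E => x - Q (R x)) := by
  ext y
  constructor
  · rintro ⟨z, rfl⟩
    exact ⟨Q z, by simp only [map_sub]⟩
  · rintro ⟨x, hx⟩
    refine ⟨y + R x, ?_⟩
    have hx' : x - Q (R x) = Q y := hx
    simp only [map_add, ← hx', map_sub]
    abel

theorem surjective_one_sub_comp_swap (Q : F →L[𝕜] E) (R : E →L[𝕜] F)
    (h : Function.Surjective (fun x : E => x - Q (R x))) :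
    Function.Surjective (fun y : F => y - R (Q y)) := by
  rw [← Set.range_eq_univ, range_one_sub_comp_swap, h.range_eq, Set.preimage_univ]

theorem isClosed_range_one_sub_comp_swap (Q : F →L[𝕜] E) (R : E →L[𝕜] F)
    (h : IsClosed (Set.range (fun x : E => x - Q (R x)))) :
    IsClosed (Set.range (fun y : F => y - R (Q y))) := by
  rw [range_one_sub_comp_swap]
  exact h.preimage Q.continuous

theorem dense_range_one_sub_comp_swap [ContinuousAdd F] (Q : F →L[𝕜] E) (R : E →L[𝕜] F)
    (h : Dense (Set.range (fun x : E => x - Q (R x)))) :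
    Dense (Set.range (fun y : F => y - R (Q y))) := by
  intro y
  have hc : Continuous (fun x : E => (y - R (Q y)) + R x) := continuous_const.add R.continuous
  have hm : Set.MapsTo (fun x : E => (y - R (Q y)) + R x)
      (Set.range (fun x : E => x - Q (R x))) (Set.range (fun z : F => z - R (Q z))) := by
    rintro _ ⟨x, rfl⟩
    refine ⟨y + R x, ?_⟩
    simp only [map_add, map_sub]
    abel
  simpa only [sub_add_cancel] using map_mem_closure hc (h (Q y)) hm

end OneSubComp


/-- Corollary A.12 (spectral part): Id_E - QR is injective / surjective / has dense
range / has closed range iff Id_F - RQ has the same property. -/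
theorem one_minus_QR_iff_one_minus_RQ
    {E F : Type*}
    [NormedAddCommGroup E] [NormedSpace ℂ E] [CompleteSpace E]
    [NormedAddCommGroup F] [NormedSpace ℂ F] [CompleteSpace F]
    (Q : F →L[ℂ] E) (R : E →L[ℂ] F) :
    (Function.Injective (fun x : E => x - Q (R x)) ↔
        Function.Injective (fun y : F => y - R (Q y))) ∧
    (Function.Surjective (fun x : E => x - Q (R x)) ↔
        Function.Surjective (fun y : F => y - R (Q y))) ∧
    (Dense (Set.range (fun x : E => x - Q (R x))) ↔
        Dense (Set.range (fun y : F => y - R (Q y)))) ∧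
    (IsClosed (Set.range (fun x : E => x - Q (R x))) ↔
        IsClosed (Set.range (fun y : F => y - R (Q y)))) := by
  exact ⟨⟨injective_one_sub_comp_swap Q R, injective_one_sub_comp_swap R Q⟩,
    ⟨surjective_one_sub_comp_swap Q R, surjective_one_sub_comp_swap R Q⟩,
    ⟨dense_range_one_sub_comp_swap Q R, dense_range_one_sub_comp_swap R Q⟩,
    ⟨isClosed_range_one_sub_comp_swap Q R, isClosed_range_one_sub_comp_swap R Q⟩⟩
end

section
/- Assume the set {j x + T y : x ∈ E, y ∈ p} (i.e. E + rg(T), the sum of the range of j and the range of T) is dense in F, and assume the set {x ∈ E : j x ∈ range T} (which equals the range of the part T₁ of T in E) is dense in E. Then the range of T is dense in F. -/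
/-- Lemma A.7.(v): if E + rg(T) is dense in F and the range of the part T₁ of T
in E is dense in E, then the range of T is dense in F. -/
theorem dense_range_of_dense_range_part
    {E F : Type*}
    [NormedAddCommGroup E] [NormedSpace ℂ E] [CompleteSpace E]
    [NormedAddCommGroup F] [NormedSpace ℂ F] [CompleteSpace F]
    (j : E →L[ℂ] F) (hj : Function.Injective j)
    (p : Submodule ℂ E) (T : p →ₗ[ℂ] F)
    (hsum : Dense {w : F | ∃ (x : E) (y : p), w = j x + T y})
    (hpart : Dense {x : E | j x ∈ Set.range T}) :
    Dense (Set.range T) := by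
  let G : Submodule ℂ F := (LinearMap.range T).topologicalClosure
  have hG : IsClosed (G : Set F) := Submodule.isClosed_topologicalClosure _
  have hT : ∀ y, T y ∈ G := fun y =>
    Submodule.le_topologicalClosure _ (LinearMap.mem_range_self T y)
  have hjG : ∀ x, j x ∈ G := by
    intro x
    have hsub : {x : E | j x ∈ Set.range T} ⊆ j ⁻¹' (G : Set F) := by
      rintro x ⟨y, hy⟩
      simpa only [Set.mem_preimage, SetLike.mem_coe, hy] using hT y
    exact closure_minimal hsub (hG.preimage j.continuous) (hpart x)
  have hsub : {w : F | ∃ (x : E) (y : p), w = j x + T y} ⊆ (G : Set F) := by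
    rintro _ ⟨x, y, rfl⟩
    exact G.add_mem (hjG x) (hT y)
  intro w
  have hw : w ∈ (G : Set F) := closure_minimal hsub hG (hsum w)
  simpa only [G, Submodule.topologicalClosure_coe, LinearMap.coe_range] using hw
end

section
/- Assume T is closed as an operator in F, i.e. the graph {(j x, T x) : x ∈ p} is closed in F × F. Then the part T₁ of T in E is closed, i.e. the set {(x, y) ∈ E × E : x ∈ p ∧ T x = j y} is closed in E × E. Moreover, if for some λ ∈ ℂ the map x ↦ λ • j x - T x is a bijection from p onto F with continuous inverse R : F → F (i.e. λ ∈ ρ(T)), then the map x ↦ λ • x - T₁ x is a bijection from p₁ onto E whose inverse R₁ : E → E is continuous and satisfies j ∘ R₁ = R ∘ j (i.e. λ ∈ ρ(T₁) and R(λ, T₁) = R(λ, T)|_E). -/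
/-- Lemma A.7.(vi): if T is closed (as an operator in F with domain p ⊆ E),
then its part T₁ in E is closed; moreover if λ ∈ ρ(T) with resolvent R, then
λ ∈ ρ(T₁) and R(λ,T₁) = R(λ,T)|_E. -/
theorem part_closed_and_resolvent
    {E F : Type*}
    [NormedAddCommGroup E] [NormedSpace ℂ E] [CompleteSpace E]
    [NormedAddCommGroup F] [NormedSpace ℂ F] [CompleteSpace F]
    (j : E →L[ℂ] F) (hj : Function.Injective j)
    (p : Submodule ℂ E) (T : p →ₗ[ℂ] F)
    (hclosed : IsClosed {q : F × F | ∃ x : p, q = (j x, T x)}) :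
    IsClosed {q : E × E | ∃ h : q.1 ∈ p, T ⟨q.1, h⟩ = j q.2} ∧
    ∀ (lam : ℂ) (R : F → F), Continuous R →
      Function.Bijective (fun x : p => lam • j (x : E) - T x) →
      (∀ x : p, R (lam • j (x : E) - T x) = j x) →
      (∀ e : E, ∃! z : E, ∃ (h : z ∈ p) (y : E), j y = T ⟨z, h⟩ ∧ lam • z - y = e) ∧
      ∃ R₁ : E → E, Continuous R₁ ∧ (∀ x : E, j (R₁ x) = R (j x)) ∧
        ∀ (z : E) (h : z ∈ p) (y : E), j y = T ⟨z, h⟩ → R₁ (lam • z - y) = z := by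
  refine ⟨?_, fun lam R hR hbij hRinv => ?_⟩
  · convert hclosed.preimage (j.continuous.prodMap j.continuous) using 1
    ext ⟨x, y⟩
    simp only [Set.mem_ofPred_eq, Set.mem_preimage, Prod.map_apply, Prod.mk.injEq]
    constructor
    · rintro ⟨h, hT⟩
      exact ⟨⟨x, h⟩, rfl, hT.symm⟩
    · rintro ⟨⟨x', h⟩, hx, hT⟩
      obtain rfl : x = x' := hj hx
      exact ⟨h, hT.symm⟩
  · let S : p →ₗ[ℂ] F := lam • (j.toLinearMap ∘ₗ p.subtype) - T
    have hS (x : p) : S x = lam • j (x : E) - T x := rfl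
    let e := LinearEquiv.ofBijective S hbij
    let R₁ : E →ₗ[ℂ] E := p.subtype ∘ₗ e.symm.toLinearMap ∘ₗ j.toLinearMap
    have hSR (x : E) : S (e.symm (j x)) = j x := e.apply_symm_apply (j x)
    have hjR (x : E) : j (R₁ x) = R (j x) := by
      rw [← hSR x, hS, hRinv]
      rfl
    have hR₁ (z : E) (h : z ∈ p) (y : E) (hy : j y = T ⟨z, h⟩) : R₁ (lam • z - y) = z := by
      apply hj
      rw [hjR, map_sub, map_smul, hy]
      exact hRinv ⟨z, h⟩
    refine ⟨fun x => ⟨R₁ x, ⟨(e.symm (j x)).2, lam • R₁ x - x, ?_, by abel⟩, ?_⟩,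
      R₁, ?_, hjR, hR₁⟩
    · rw [map_sub, map_smul]
      exact sub_eq_iff_eq_add'.mpr (sub_eq_iff_eq_add.mp (hSR x))
    · rintro z ⟨h, y, hy, rfl⟩
      exact (hR₁ z h y hy).symm
    · apply R₁.continuous_of_isClosed_graph
      have hgraph : (R₁.graph : Set (E × E)) = {q | j q.2 = R (j q.1)} := by
        ext q
        simp only [SetLike.mem_coe, LinearMap.mem_graph_iff, Set.mem_ofPred_eq, ← hjR, hj.eq_iff]
      rw [hgraph]
      exact isClosed_eq (j.continuous.comp continuous_snd)
        (hR.comp (j.continuous.comp continuous_fst))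
end

section
/- For λ ∈ ℂ, the map f ↦ λ f - A_m f is a bijection from ker L onto X with continuous inverse (i.e. λ ∈ ρ(A)) if and only if all three of the following hold: (i) A is closed, i.e. the graph {(f, A_m f) : f ∈ ker L} is closed in X × X; (ii) the map f ↦ λ f - A_m f from p to X is surjective; and (iii) the restriction of L to ker(λ - A_m) is a bijection onto ∂X (i.e. for every x ∈ ∂X the abstract Dirichlet problem A_m f = λ f, L f = x has a unique solution f ∈ p). -/
/-- Lemma 3.1: λ ∈ ρ(A) (i.e. λ - A_m : ker L → X is bijective with continuous
inverse) iff (i) A is closed, (ii) λ - A_m : D(A_m) → X is surjective, and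
(iii) the Dirichlet operator L_λ exists, i.e. for every x ∈ ∂X the abstract
Dirichlet problem has a unique solution. -/
theorem resolvent_iff_closed_surjective_dirichlet
    {X Xb : Type*}
    [NormedAddCommGroup X] [NormedSpace ℂ X] [CompleteSpace X]
    [NormedAddCommGroup Xb] [NormedSpace ℂ Xb] [CompleteSpace Xb]
    (p : Submodule ℂ X) (Am : p →ₗ[ℂ] X) (L : p →ₗ[ℂ] Xb)
    (hL : Function.Surjective L) (lam : ℂ) :
    (∃ Rr : X → X, Continuous Rr ∧
        (∀ x : X, ∃ h : Rr x ∈ p, L ⟨Rr x, h⟩ = 0 ∧ lam • Rr x - Am ⟨Rr x, h⟩ = x) ∧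
        (∀ f : p, L f = 0 → Rr (lam • (f : X) - Am f) = (f : X))) ↔
    (IsClosed {q : X × X | ∃ f : p, L f = 0 ∧ q = ((f : X), Am f)} ∧
      Function.Surjective (fun f : p => lam • (f : X) - Am f) ∧
      ∀ x : Xb, ∃! f : p, Am f = lam • (f : X) ∧ L f = x) := by
  constructor
  · rintro ⟨R, hR, hright, hleft⟩
    refine ⟨?_, fun x => ?_, fun x => ?_⟩
    · have hgraph : {q : X × X | ∃ f : p, L f = 0 ∧ q = ((f : X), Am f)} =
          {q : X × X | R (lam • q.1 - q.2) = q.1} := by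
        ext ⟨a, b⟩
        constructor
        · rintro ⟨f, hf, hq⟩
          obtain ⟨rfl, rfl⟩ := Prod.mk.inj hq
          exact hleft f hf
        · intro hq
          obtain ⟨h, hL0, heq⟩ := hright (lam • a - b)
          refine ⟨⟨R (lam • a - b), h⟩, hL0, Prod.ext hq.symm ?_⟩
          have hq' : R (lam • a - b) = a := hq
          have h2 := heq
          nth_rewrite 1 [hq'] at h2
          exact (sub_right_injective h2).symm
      rw [hgraph]
      exact isClosed_eq (hR.comp (by fun_prop)) continuous_fst
    · obtain ⟨h, -, heq⟩ := hright x
      exact ⟨⟨R x, h⟩, heq⟩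
    · obtain ⟨f, rfl⟩ := hL x
      obtain ⟨h, hL0, heq⟩ := hright (lam • (f : X) - Am f)
      refine ⟨f - ⟨_, h⟩, ⟨?_, by simp [hL0]⟩, ?_⟩
      · rw [map_sub, Submodule.coe_sub, smul_sub]
        linear_combination (norm := module) heq
      · rintro g ⟨hg, hLg⟩
        have key := hleft (f - g) (by simp [hLg])
        have harg : lam • ((f - g : p) : X) - Am (f - g) = lam • (f : X) - Am f := by
          rw [map_sub, Submodule.coe_sub, smul_sub, hg]
          abel
        rw [harg] at key
        apply Subtype.ext
        simp [key]
  · rintro ⟨hclosed, hsurj, hdir⟩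
    let T : LinearMap.ker L →ₗ[ℂ] X := (lam • p.subtype - Am) ∘ₗ (LinearMap.ker L).subtype
    have hT : Function.Bijective T := by
      constructor
      · rw [← LinearMap.ker_eq_bot, LinearMap.ker_eq_bot']
        intro f hf
        have hf' : lam • ((f : p) : X) - Am f = 0 := hf
        exact Subtype.ext ((hdir 0).unique ⟨(sub_eq_zero.mp hf').symm, f.2⟩ ⟨by simp, map_zero L⟩)
      · intro x
        obtain ⟨f, rfl⟩ := hsurj x
        obtain ⟨u, ⟨hu, hLu⟩, -⟩ := hdir (L f)
        refine ⟨⟨f - u, by simp [hLu]⟩, ?_⟩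
        change lam • ((f - u : p) : X) - Am (f - u) = lam • (f : X) - Am f
        rw [map_sub, Submodule.coe_sub, smul_sub, hu]
        abel
    let e := LinearEquiv.ofBijective T hT
    let R : X →ₗ[ℂ] X := p.subtype ∘ₗ (LinearMap.ker L).subtype ∘ₗ e.symm.toLinearMap
    have hright (x : X) : lam • R x - Am (e.symm x : p) = x := e.apply_symm_apply x
    have hleft (f : p) (hf : L f = 0) : R (lam • (f : X) - Am f) = (f : X) :=
      congrArg (fun g : LinearMap.ker L => ((g : p) : X)) (e.symm_apply_apply ⟨f, hf⟩)
    refine ⟨R, R.continuous_of_isClosed_graph ?_,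
      fun x => ⟨(e.symm x : p).2, (e.symm x).2, hright x⟩, hleft⟩
    have hgraph : (R.graph : Set (X × X)) = (fun q : X × X => (q.2, lam • q.2 - q.1)) ⁻¹'
        {q : X × X | ∃ f : p, L f = 0 ∧ q = ((f : X), Am f)} := by
      ext ⟨x, y⟩
      simp only [SetLike.mem_coe, LinearMap.mem_graph_iff, Set.mem_preimage, Set.mem_ofPred_eq,
        Prod.mk.injEq]
      constructor
      · rintro rfl
        exact ⟨e.symm x, (e.symm x).2, rfl, sub_eq_iff_eq_add.mpr
          (sub_eq_iff_eq_add'.mp (hright x))⟩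
      · rintro ⟨f, hf, rfl, hx⟩
        rw [← hleft f hf, ← hx, sub_sub_cancel]
    rw [hgraph]
    exact hclosed.preimage (by fun_prop)
end

section
/- Assume ρ(A) ≠ ∅, i.e. there exists μ ∈ ℂ such that f ↦ μ f - A_m f is a bijection from ker L onto X with continuous inverse. Then the following are equivalent: (a) the joint graph {(f, A_m f, L f) : f ∈ p} is closed in X × X × ∂X; (b) for every λ ∈ ℂ such that f ↦ λ f - A_m f is a bijection from ker L onto X with continuous inverse, the restriction L|_{ker(λ - A_m)} is a bijection onto ∂X whose inverse L_λ : ∂X → X is continuous; (c) for some such λ, the restriction L|_{ker(λ - A_m)} is a bijection onto ∂X whose inverse L_λ : ∂X → X is continuous. -/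
/-- λ ∈ ρ(A): the map f ↦ λf - A_m f is a bijection from ker L onto X with
continuous inverse. -/
def IsResolventPt {X Xb : Type*}
    [NormedAddCommGroup X] [NormedSpace ℂ X]
    [NormedAddCommGroup Xb] [NormedSpace ℂ Xb]
    (p : Submodule ℂ X) (Am : p →ₗ[ℂ] X) (L : p →ₗ[ℂ] Xb) (lam : ℂ) : Prop :=
  ∃ Rr : X → X, Continuous Rr ∧
    (∀ x : X, ∃ h : Rr x ∈ p, L ⟨Rr x, h⟩ = 0 ∧ lam • Rr x - Am ⟨Rr x, h⟩ = x) ∧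
    (∀ f : p, L f = 0 → Rr (lam • (f : X) - Am f) = (f : X))

/-- L restricted to ker(λ - A_m) is a bijection onto ∂X with continuous inverse
L_λ (the Dirichlet operator exists and is bounded). -/
def HasBoundedDirichletOp {X Xb : Type*}
    [NormedAddCommGroup X] [NormedSpace ℂ X]
    [NormedAddCommGroup Xb] [NormedSpace ℂ Xb]
    (p : Submodule ℂ X) (Am : p →ₗ[ℂ] X) (L : p →ₗ[ℂ] Xb) (lam : ℂ) : Prop :=
  ∃ Llam : Xb → X, Continuous Llam ∧
    (∀ x : Xb, ∃ h : Llam x ∈ p, Am ⟨Llam x, h⟩ = lam • Llam x ∧ L ⟨Llam x, h⟩ = x) ∧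
    (∀ f : p, Am f = lam • (f : X) → Llam (L f) = (f : X))

/-- At a resolvent point, `L` restricted to the eigenspace `ker (lam - Am)` is a bijection. -/
theorem IsResolventPt.bijective_domRestrict
    {X Xb : Type*}
    [NormedAddCommGroup X] [NormedSpace ℂ X]
    [NormedAddCommGroup Xb] [NormedSpace ℂ Xb]
    {p : Submodule ℂ X} {Am : p →ₗ[ℂ] X} {L : p →ₗ[ℂ] Xb} {lam : ℂ}
    (hL : Function.Surjective L) (hr : IsResolventPt p Am L lam) :
    Function.Bijective (L.domRestrict (LinearMap.ker (lam • p.subtype - Am))) := by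
  obtain ⟨R, -, hR, hR'⟩ := hr
  constructor
  · rw [← LinearMap.ker_eq_bot, LinearMap.ker_eq_bot']
    rintro ⟨f, hf⟩ h0
    have hf' : lam • (f : X) - Am f = 0 := by simpa using hf
    have h1 := hR' f h0
    have h2 := hR' 0 (map_zero L)
    rw [hf'] at h1
    simp only [ZeroMemClass.coe_zero, smul_zero, map_zero, sub_zero] at h2
    ext
    exact h1.symm.trans h2
  · intro x
    obtain ⟨g, rfl⟩ := hL x
    obtain ⟨h, h0, h1⟩ := hR (lam • (g : X) - Am g)
    refine ⟨⟨g - ⟨R (lam • (g : X) - Am g), h⟩, ?_⟩, ?_⟩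
    · simp only [LinearMap.mem_ker, LinearMap.sub_apply, LinearMap.smul_apply,
        Submodule.subtype_apply, map_sub]
      linear_combination (norm := module) -h1
    · simp [h0]

/-- If the joint graph of `Am` and `L` is closed, bounded Dirichlet operators exist at all
resolvent points. -/
theorem IsResolventPt.hasBoundedDirichletOp_of_isClosed
    {X Xb : Type*}
    [NormedAddCommGroup X] [NormedSpace ℂ X] [CompleteSpace X]
    [NormedAddCommGroup Xb] [NormedSpace ℂ Xb] [CompleteSpace Xb]
    {p : Submodule ℂ X} {Am : p →ₗ[ℂ] X} {L : p →ₗ[ℂ] Xb} {lam : ℂ}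
    (hL : Function.Surjective L) (hr : IsResolventPt p Am L lam)
    (hc : IsClosed {q : X × X × Xb | ∃ f : p, q = ((f : X), Am f, L f)}) :
    HasBoundedDirichletOp p Am L lam := by
  let e := LinearEquiv.ofBijective _ (hr.bijective_domRestrict hL)
  have hA (x : Xb) : Am (e.symm x) = lam • ((e.symm x : p) : X) := by
    have h := (e.symm x).2
    rw [LinearMap.mem_ker, LinearMap.sub_apply, sub_eq_zero] at h
    exact h.symm
  have hLe (x : Xb) : L (e.symm x) = x := e.apply_symm_apply x
  have hsymm (f : p) (hf : Am f = lam • (f : X)) : (e.symm (L f) : p) = f := by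
    have hm : f ∈ LinearMap.ker (lam • p.subtype - Am) := by simp [hf]
    exact congrArg Subtype.val (e.symm_apply_apply ⟨f, hm⟩)
  let T : Xb →ₗ[ℂ] X := p.subtype ∘ₗ Submodule.subtype _ ∘ₗ e.symm.toLinearMap
  refine ⟨T, T.continuous_of_isClosed_graph ?_, fun x => ⟨(e.symm x : p).2, hA x, hLe x⟩,
    fun f hf => congrArg Subtype.val (hsymm f hf)⟩
  have hcont : Continuous fun q : Xb × X => (q.2, lam • q.2, q.1) := by fun_prop
  convert hc.preimage hcont using 1
  ext ⟨x, y⟩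
  simp only [SetLike.mem_coe, LinearMap.mem_graph_iff, Set.mem_preimage, Set.mem_ofPred_eq,
    Prod.mk.injEq]
  constructor
  · rintro rfl
    exact ⟨e.symm x, rfl, (hA x).symm, (hLe x).symm⟩
  · rintro ⟨f, rfl, h1, rfl⟩
    exact (congrArg Subtype.val (hsymm f h1.symm)).symm

/-- A bounded Dirichlet operator at one resolvent point forces the joint graph of `Am` and `L`
to be closed. -/
theorem IsResolventPt.isClosed_of_hasBoundedDirichletOp
    {X Xb : Type*}
    [NormedAddCommGroup X] [NormedSpace ℂ X]
    [NormedAddCommGroup Xb] [NormedSpace ℂ Xb]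
    {p : Submodule ℂ X} {Am : p →ₗ[ℂ] X} {L : p →ₗ[ℂ] Xb} {lam : ℂ}
    (hr : IsResolventPt p Am L lam) (hD : HasBoundedDirichletOp p Am L lam) :
    IsClosed {q : X × X × Xb | ∃ f : p, q = ((f : X), Am f, L f)} := by
  obtain ⟨R, hRc, hR, hR'⟩ := hr
  obtain ⟨D, hDc, hD, -⟩ := hD
  have hclosed : IsClosed {q : X × X × Xb | q.1 = R (lam • q.1 - q.2.1) + D q.2.2} :=
    isClosed_eq (by fun_prop) (by fun_prop)
  convert hclosed using 1
  ext ⟨f, g, x⟩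
  simp only [Set.mem_ofPred_eq, Prod.mk.injEq]
  constructor
  · rintro ⟨f, rfl, rfl, rfl⟩
    obtain ⟨h, h1, h2⟩ := hD (L f)
    have h3 := hR' (f - ⟨D (L f), h⟩) (by rw [map_sub, h2, sub_self])
    rw [map_sub, h1, AddSubgroupClass.coe_sub, smul_sub, sub_sub_sub_cancel_right] at h3
    rw [h3, sub_add_cancel]
  · intro hf
    obtain ⟨h, h1, h2⟩ := hR (lam • f - g)
    obtain ⟨k, k1, k2⟩ := hD x
    refine ⟨⟨R (lam • f - g), h⟩ + ⟨D x, k⟩, hf, ?_, ?_⟩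
    · have h3 : lam • f = lam • R (lam • f - g) + lam • D x := by rw [← smul_add, ← hf]
      rw [map_add, k1]
      linear_combination (norm := module) h3 + h2
    · rw [map_add, h1, k2, zero_add]

/-- Lemma 3.2: if ρ(A) ≠ ∅ then the following are equivalent:
(a) the operator (A_m, L) is closed; (b) the Dirichlet operator L_λ ∈ L(∂X, X)
exists for all λ ∈ ρ(A); (c) it exists for some λ ∈ ρ(A). -/
theorem closed_iff_dirichlet_ops_exist
    {X Xb : Type*}
    [NormedAddCommGroup X] [NormedSpace ℂ X] [CompleteSpace X]
    [NormedAddCommGroup Xb] [NormedSpace ℂ Xb] [CompleteSpace Xb]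
    (p : Submodule ℂ X) (Am : p →ₗ[ℂ] X) (L : p →ₗ[ℂ] Xb)
    (hL : Function.Surjective L)
    (hres : ∃ mu : ℂ, IsResolventPt p Am L mu) :
    (IsClosed {q : X × X × Xb | ∃ f : p, q = ((f : X), Am f, L f)} ↔
        ∀ lam : ℂ, IsResolventPt p Am L lam → HasBoundedDirichletOp p Am L lam) ∧
    ((∀ lam : ℂ, IsResolventPt p Am L lam → HasBoundedDirichletOp p Am L lam) ↔
        ∃ lam : ℂ, IsResolventPt p Am L lam ∧ HasBoundedDirichletOp p Am L lam) := by
  have hca : (∃ lam : ℂ, IsResolventPt p Am L lam ∧ HasBoundedDirichletOp p Am L lam) →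
      IsClosed {q : X × X × Xb | ∃ f : p, q = ((f : X), Am f, L f)} :=
    fun ⟨_, hr, hD⟩ => hr.isClosed_of_hasBoundedDirichletOp hD
  have hab : IsClosed {q : X × X × Xb | ∃ f : p, q = ((f : X), Am f, L f)} →
      ∀ lam : ℂ, IsResolventPt p Am L lam → HasBoundedDirichletOp p Am L lam :=
    fun hc _ hr => hr.hasBoundedDirichletOp_of_isClosed hL hc
  have hbc : (∀ lam : ℂ, IsResolventPt p Am L lam → HasBoundedDirichletOp p Am L lam) →
      ∃ lam : ℂ, IsResolventPt p Am L lam ∧ HasBoundedDirichletOp p Am L lam :=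
    fun hb => hres.imp fun mu hr => ⟨hr, hb mu hr⟩
  exact ⟨⟨hab, hca ∘ hbc⟩, ⟨hbc, hab ∘ hca⟩⟩
end

section
/- Assume for some λ ∈ ℂ the restriction L|_{ker(λ - A_m)} is a bijection onto ∂X with inverse L_λ : ∂X → ker(λ - A_m), and let μ ∈ ℂ be such that f ↦ μ f - A_m f is a bijection from ker L onto X with (algebraic) inverse R : X → ker L (i.e. μ ∈ ρ(A) with resolvent R = R(μ, A)). Then the restriction L|_{ker(μ - A_m)} is a bijection onto ∂X, and its inverse L_μ is given by L_μ x = L_λ x + (λ - μ) • R (L_λ x) for all x ∈ ∂X (the formula L_μ = (λ - A) R(μ, A) L_λ). -/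
/-- Lemma 3.4.(i): if the Dirichlet operator L_λ exists for some λ and
μ ∈ ρ(A) with resolvent R = R(μ,A), then L_μ exists and is given by
L_μ = L_λ + (λ - μ) R L_λ (the formula L_μ = (λ - A) R(μ,A) L_λ). -/
theorem dirichlet_op_formula
    {X Xb : Type*}
    [NormedAddCommGroup X] [NormedSpace ℂ X] [CompleteSpace X]
    [NormedAddCommGroup Xb] [NormedSpace ℂ Xb] [CompleteSpace Xb]
    (p : Submodule ℂ X) (Am : p →ₗ[ℂ] X) (L : p →ₗ[ℂ] Xb)
    (hL : Function.Surjective L)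
    (lam mu : ℂ) (Llam : Xb → X)
    (hLlam : ∀ x : Xb, ∃ h : Llam x ∈ p, Am ⟨Llam x, h⟩ = lam • Llam x ∧ L ⟨Llam x, h⟩ = x)
    (hLlam' : ∀ f : p, Am f = lam • (f : X) → Llam (L f) = (f : X))
    (R : X → X)
    (hR : ∀ x : X, ∃ h : R x ∈ p, L ⟨R x, h⟩ = 0 ∧ mu • R x - Am ⟨R x, h⟩ = x)
    (hR' : ∀ f : p, L f = 0 → R (mu • (f : X) - Am f) = (f : X)) :
    (∀ x : Xb, ∃ h : Llam x + (lam - mu) • R (Llam x) ∈ p,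
        Am ⟨Llam x + (lam - mu) • R (Llam x), h⟩ = mu • (Llam x + (lam - mu) • R (Llam x)) ∧
        L ⟨Llam x + (lam - mu) • R (Llam x), h⟩ = x) ∧
    (∀ f : p, Am f = mu • (f : X) → Llam (L f) + (lam - mu) • R (Llam (L f)) = (f : X)) := by
  have formula : ∀ x : Xb, ∃ h : Llam x + (lam - mu) • R (Llam x) ∈ p,
      Am ⟨Llam x + (lam - mu) • R (Llam x), h⟩ = mu • (Llam x + (lam - mu) • R (Llam x)) ∧
      L ⟨Llam x + (lam - mu) • R (Llam x), h⟩ = x := by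
    intro x
    obtain ⟨hu, hAu, hLu⟩ := hLlam x
    obtain ⟨hr, hLr, hAr⟩ := hR (Llam x)
    have hsum : (⟨Llam x + (lam - mu) • R (Llam x), p.add_mem hu (p.smul_mem _ hr)⟩ : p) =
        ⟨Llam x, hu⟩ + (lam - mu) • ⟨R (Llam x), hr⟩ := rfl
    refine ⟨p.add_mem hu (p.smul_mem _ hr), ?_, ?_⟩
    · have hAr' : Am ⟨R (Llam x), hr⟩ = mu • R (Llam x) - Llam x := by
        rw [eq_sub_iff_add_eq, add_comm]
        exact (sub_eq_iff_eq_add.mp hAr).symm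
      rw [hsum, map_add, map_smul, hAu, hAr']
      module
    · rw [hsum, map_add, map_smul, hLu, hLr, smul_zero, add_zero]
  refine ⟨formula, fun f hf => ?_⟩
  obtain ⟨h, hA, hLf⟩ := formula (L f)
  have hR0 : R 0 = 0 := by simpa using hR' 0 (map_zero L)
  have key := hR' (f - ⟨_, h⟩) (by rw [map_sub, hLf, sub_self])
  rw [map_sub, hf, hA, Submodule.coe_sub, smul_sub, sub_self, hR0] at key
  exact (sub_eq_zero.mp key.symm).symm
end

section
/- Let Φ : p → ∂X be a linear map. Assume there exists λ₀ ∈ ℂ such that the restriction L|_{ker(λ₀ - A_m)} is a bijection onto ∂X, and assume Φ '' (ker(λ₀ - A_m)) ⊆ Φ '' (ker L), i.e. the image under Φ of ker(λ₀ - A_m) is contained in the image under Φ of D(A) = ker L. Then the linear map L - Φ : p → ∂X is surjective; in fact, for every x ∈ ∂X there exists f ∈ p with L f = x and Φ f = 0. -/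
/-- Lemma 3.12: if for some λ₀ the restriction L|_{ker(λ₀ - A_m)} is a bijection
onto ∂X and Φ(ker(λ₀ - A_m)) ⊆ Φ(D(A)), then L - Φ : D(A_m) → ∂X is surjective;
in fact every x ∈ ∂X has a preimage f with L f = x and Φ f = 0. -/
theorem L_sub_Phi_surjective
    {X Xb : Type*}
    [NormedAddCommGroup X] [NormedSpace ℂ X] [CompleteSpace X]
    [NormedAddCommGroup Xb] [NormedSpace ℂ Xb] [CompleteSpace Xb]
    (p : Submodule ℂ X) (Am : p →ₗ[ℂ] X) (L : p →ₗ[ℂ] Xb)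
    (hL : Function.Surjective L)
    (Phi : p →ₗ[ℂ] Xb) (lam0 : ℂ)
    (hbij : ∀ x : Xb, ∃! f : p, Am f = lam0 • (f : X) ∧ L f = x)
    (hsub : Phi '' {f : p | Am f = lam0 • (f : X)} ⊆ Phi '' {f : p | L f = 0}) :
    Function.Surjective (L - Phi) ∧
    ∀ x : Xb, ∃ f : p, L f = x ∧ Phi f = 0 := by
  have key : ∀ x : Xb, ∃ f : p, L f = x ∧ Phi f = 0 := by
    intro x
    obtain ⟨g, ⟨hg, hgx⟩, -⟩ := hbij x
    obtain ⟨h, hh, hhg⟩ := hsub ⟨g, hg, rfl⟩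
    have hh' : L h = 0 := hh
    exact ⟨g - h, by rw [map_sub, hgx, hh', sub_zero], by rw [map_sub, hhg, sub_self]⟩
  refine ⟨fun x => ?_, key⟩
  obtain ⟨f, hf, hf0⟩ := key x
  exact ⟨f, by rw [LinearMap.sub_apply, hf, hf0, sub_zero]⟩
end
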